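/- Let M be a positive integer and q ∈ (1, M+1]. Suppose q belongs to the closure of U, q ≠ q', and q is not the right endpoint q_0^* of any connected component of (1, M+1) \ closure(U). Then for every p ∈ (1, q) the Hausdorff dimension of U ∩ (p, q) is strictly positive. -/

import Mathlib

open Set MeasureTheory Filter

noncomputable section

/-- The projection `π_q` of a digit sequence (0-indexed): `∑ d i / q^(i+1)`. -/
def piQ (q : ℝ) (d : ℕ → ℕ) : ℝ := ∑' i : ℕ, (d i : ℝ) / q ^ (i + 1)

/-- `d` is a `q`-expansion of `x` over the alphabet `{0,…,M}`. -/
def IsExpansion (M : ℕ) (q x : ℝ) (d : ℕ → ℕ) : Prop :=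
  (∀ i, d i ≤ M) ∧ piQ q d = x

/-- `U'_q`: digit sequences that are the unique `q`-expansion of their projection. -/
def UnivSeqs (M : ℕ) (q : ℝ) : Set (ℕ → ℕ) :=
  {d | (∀ i, d i ≤ M) ∧ ∀ e : ℕ → ℕ, IsExpansion M q (piQ q d) e → e = d}

/-- The set `U = U(M)` of univoque bases: `q ∈ (1, M+1]` such that `1` has a
unique `q`-expansion over `{0,…,M}`. -/
def UnivBases (M : ℕ) : Set ℝ :=
  {q | 1 < q ∧ q ≤ M + 1 ∧ ∃! d : ℕ → ℕ, IsExpansion M q 1 d}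

/-- The Komornik–Loreti constant `q'(M) = min U(M)`. -/
def KL (M : ℕ) : ℝ := sInf (UnivBases M)

/-- `(a, b)` is a connected component of `(q'(M), M+1) \ closure (U(M))`:
an open subinterval whose endpoints do not lie in that (open) set. -/
def CC (M : ℕ) (a b : ℝ) : Prop :=
  a < b ∧ Ioo a b ⊆ Ioo (KL M) (M + 1) \ closure (UnivBases M) ∧
    a ∉ Ioo (KL M) (M + 1) \ closure (UnivBases M) ∧
    b ∉ Ioo (KL M) (M + 1) \ closure (UnivBases M)

/-- `x ∈ [0, M/(q-1)]` has exactly two distinct `q`-expansions. -/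
def HasExactlyTwoExpansions (M : ℕ) (q x : ℝ) : Prop :=
  ∃ c d : ℕ → ℕ, c ≠ d ∧ IsExpansion M q x c ∧ IsExpansion M q x d ∧
    ∀ e : ℕ → ℕ, IsExpansion M q x e → e = c ∨ e = d

/-- `B_2(M)`: bases `q ∈ (1, M+1]` for which some `x ∈ [0, M/(q-1)]` has exactly
two `q`-expansions. -/
def B2 (M : ℕ) : Set ℝ :=
  {q | 1 < q ∧ q ≤ M + 1 ∧
    ∃ x ∈ Icc (0 : ℝ) (M / (q - 1)), HasExactlyTwoExpansions M q x}

/-- Strict lexicographic order on digit sequences. -/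
def seqLt (a b : ℕ → ℕ) : Prop := ∃ n, (∀ i < n, a i = b i) ∧ a n < b n

/-- Lexicographic order on digit sequences. -/
def seqLe (a b : ℕ → ℕ) : Prop := seqLt a b ∨ a = b

/-- A digit sequence is infinite if it does not end with `0^∞` after a last
nonzero digit (in particular `0^∞` is infinite). -/
def IsInfiniteSeq (a : ℕ → ℕ) : Prop := ¬∃ m, a m ≠ 0 ∧ ∀ i > m, a i = 0

/-- `a = α(q)`, the quasi-greedy `q`-expansion of `1`: the lexicographically
largest infinite `q`-expansion of `1`. -/
def IsQuasiGreedy (M : ℕ) (q : ℝ) (a : ℕ → ℕ) : Prop :=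
  IsExpansion M q 1 a ∧ IsInfiniteSeq a ∧
    ∀ b : ℕ → ℕ, IsExpansion M q 1 b → IsInfiniteSeq b → seqLe b a

/-- `b = β(q)`, the greedy `q`-expansion of `1`: the lexicographically largest
`q`-expansion of `1`. -/
def IsGreedy (M : ℕ) (q : ℝ) (b : ℕ → ℕ) : Prop :=
  IsExpansion M q 1 b ∧ ∀ c : ℕ → ℕ, IsExpansion M q 1 c → seqLe c b

/-- `w⁺`: increase the last digit of a word by one. -/
def plusWord : List ℕ → List ℕ
  | [] => []
  | [a] => [a + 1]
  | a :: b :: rest => a :: plusWord (b :: rest)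

/-- `w⁻`: decrease the last digit of a word by one. -/
def minusWord : List ℕ → List ℕ
  | [] => []
  | [a] => [a - 1]
  | a :: b :: rest => a :: minusWord (b :: rest)

/-- The reflection of a word: `\overline{w} = (M - w_1) ⋯ (M - w_k)`. -/
def reflWord (M : ℕ) (w : List ℕ) : List ℕ := w.map fun a => M - a

/-- The substitution `g(w) = w⁺ \overline{w⁺}`. -/
def gWord (M : ℕ) (w : List ℕ) : List ℕ := plusWord w ++ reflWord M (plusWord w)

/-- The periodic sequence `t^∞` determined by a word `t`. -/
def periodicSeq (t : List ℕ) (i : ℕ) : ℕ := t.getD (i % t.length) 0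

/-- Strict lexicographic order on words. -/
def wordLt (u v : List ℕ) : Prop := List.Lex (· < ·) u v

/-- Lexicographic order on words. -/
def wordLe (u v : List ℕ) : Prop := wordLt u v ∨ u = v

/-- The connected component `(q_0, q_0^*)` of `(q'(M), M+1) \ closure (U(M))` is
generated by the word `t`, and `θ = α(q_0^*)`: `α(q_0) = t^∞` and
`α(q_0^*) = lim_{n→∞} g^n(t)`, i.e. every `g^n(t)` is a prefix of `θ`. -/
def GeneratedBy (M : ℕ) (q₀ q₀star : ℝ) (t : List ℕ) (θ : ℕ → ℕ) : Prop :=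
  CC M q₀ q₀star ∧ t ≠ [] ∧ IsQuasiGreedy M q₀ (periodicSeq t) ∧
    IsQuasiGreedy M q₀star θ ∧
    ∀ n : ℕ, ∀ i < ((gWord M)^[n] t).length, ((gWord M)^[n] t).getD i 0 = θ i


/-- The `n`-th shift of a digit sequence. -/
def shiftSeq (n : ℕ) (a : ℕ → ℕ) : ℕ → ℕ := fun i => a (n + i)

/-- The reflection of a digit sequence. -/
def barSeq (M : ℕ) (a : ℕ → ℕ) : ℕ → ℕ := fun i => M - a i

/-- Digit sequences all of whose proper shifts, and their reflections, are lexicographically smaller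
than the sequence itself. -/
def IsLexUnivoque (M : ℕ) (x : ℕ → ℕ) : Prop :=
  (∀ i, x i ≤ M) ∧ ∀ n, 1 ≤ n → seqLt (shiftSeq n x) x ∧ seqLt (barSeq M (shiftSeq n x)) x

/-- Strict lexicographic order on the prefixes of length `n`. -/
def prefLt (n : ℕ) (a b : ℕ → ℕ) : Prop := ∃ k < n, (∀ i < k, a i = b i) ∧ a k < b k

/-- Lexicographic order on the prefixes of length `n`. -/
def prefLe (n : ℕ) (a b : ℕ → ℕ) : Prop := prefLt n a b ∨ ∀ i < n, a i = b i

/-- Decrease the digit at position `m - 1` by one. -/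
def lowerLast (m : ℕ) (v : ℕ → ℕ) : ℕ → ℕ := fun i => if i + 1 = m then v i - 1 else v i

theorem shiftSeq_shiftSeq (m n : ℕ) (a : ℕ → ℕ) :
    shiftSeq m (shiftSeq n a) = shiftSeq (n + m) a := by
  funext i; simp [shiftSeq, add_assoc]

theorem seqLt_trichotomy {a b : ℕ → ℕ} (h : a ≠ b) : seqLt a b ∨ seqLt b a := by
  classical
  have hex : ∃ n, a n ≠ b n := Function.ne_iff.mp h
  have hmin : ∀ i < Nat.find hex, a i = b i := fun i hi => by
    simpa using Nat.find_min hex hi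
  rcases lt_or_gt_of_ne (Nat.find_spec hex) with h1 | h1
  · exact Or.inl ⟨_, hmin, h1⟩
  · exact Or.inr ⟨_, fun i hi => (hmin i hi).symm, h1⟩

theorem seqLt_trans {a b c : ℕ → ℕ} (h₁ : seqLt a b) (h₂ : seqLt b c) : seqLt a c := by
  obtain ⟨n, hn, hn'⟩ := h₁
  obtain ⟨k, hk, hk'⟩ := h₂
  rcases lt_trichotomy n k with h | h | h
  · exact ⟨n, fun i hi => (hn i hi).trans (hk i (hi.trans h)), hk n h ▸ hn'⟩
  · subst h
    exact ⟨n, fun i hi => (hn i hi).trans (hk i hi), hn'.trans hk'⟩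
  · exact ⟨k, fun i hi => (hn i (hi.trans h)).trans (hk i hi), (hn k h).symm ▸ hk'⟩

theorem seqLt_irrefl (a : ℕ → ℕ) : ¬ seqLt a a := fun ⟨_, _, h⟩ => lt_irrefl _ h

theorem prefLt.seqLt {n : ℕ} {a b : ℕ → ℕ} (h : prefLt n a b) : seqLt a b :=
  let ⟨k, _, h1, h2⟩ := h
  ⟨k, h1, h2⟩

theorem prefLt.mono {n n' : ℕ} {a b : ℕ → ℕ} (h : prefLt n a b) (hn : n ≤ n') : prefLt n' a b :=
  let ⟨k, hk, h1⟩ := h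
  ⟨k, hk.trans_le hn, h1⟩

theorem prefLt.congr {n : ℕ} {a b a' b' : ℕ → ℕ} (h : prefLt n a b) (ha : ∀ i < n, a' i = a i)
    (hb : ∀ i < n, b' i = b i) : prefLt n a' b' := by
  obtain ⟨k, hk, h1, h2⟩ := h
  refine ⟨k, hk, fun i hi => ?_, ?_⟩
  · rw [ha i (hi.trans hk), hb i (hi.trans hk), h1 i hi]
  · rwa [ha k hk, hb k hk]

theorem prefLe.congr {n : ℕ} {a b a' b' : ℕ → ℕ} (h : prefLe n a b) (ha : ∀ i < n, a' i = a i)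
    (hb : ∀ i < n, b' i = b i) : prefLe n a' b' := by
  rcases h with h | h
  · exact Or.inl (h.congr ha hb)
  · exact Or.inr fun i hi => by rw [ha i hi, hb i hi, h i hi]

theorem seqLt.prefLe {a b : ℕ → ℕ} (h : seqLt a b) (n : ℕ) : prefLe n a b := by
  obtain ⟨k, h1, h2⟩ := h
  by_cases hk : k < n
  · exact Or.inl ⟨k, hk, h1, h2⟩
  · exact Or.inr fun i hi => h1 i (by omega)

theorem prefLt.prefLt_append {j n : ℕ} {a b : ℕ → ℕ} (h : ∀ i < j, a i = b i)
    (h' : prefLt n (shiftSeq j a) (shiftSeq j b)) : prefLt (j + n) a b := by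
  obtain ⟨k, hk, h1, h2⟩ := h'
  refine ⟨j + k, by omega, fun i hi => ?_, h2⟩
  by_cases hij : i < j
  · exact h i hij
  · have := h1 (i - j) (by omega)
    simpa [shiftSeq, Nat.add_sub_cancel' (not_lt.mp hij)] using this

theorem prefLt.trans_prefLe {n : ℕ} {a b c : ℕ → ℕ} (h₁ : prefLt n a b) (h₂ : prefLe n b c) :
    prefLt n a c := by
  obtain ⟨k, hk, h1, h1'⟩ := h₁
  rcases h₂ with ⟨l, hl, h2, h2'⟩ | h2
  · rcases lt_trichotomy k l with h | h | h
    · exact ⟨k, hk, fun i hi => (h1 i hi).trans (h2 i (hi.trans h)), h2 k h ▸ h1'⟩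
    · subst h
      exact ⟨k, hk, fun i hi => (h1 i hi).trans (h2 i hi), h1'.trans h2'⟩
    · exact ⟨l, hl, fun i hi => (h1 i (hi.trans h)).trans (h2 i hi), (h1 l h).symm ▸ h2'⟩
  · exact ⟨k, hk, fun i hi => (h1 i hi).trans (h2 i (hi.trans hk)), h2 k hk ▸ h1'⟩

/-- If the last digit is raised by at most one, a strict inequality of prefixes becomes weak. -/
theorem prefLt.prefLe_of_le_succ {n : ℕ} {a a' b : ℕ → ℕ} (h : prefLt n a b)
    (ha : ∀ i, i + 1 < n → a' i = a i) (hl : ∀ i, i + 1 = n → a' i ≤ a i + 1) :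
    prefLe n a' b := by
  obtain ⟨k, hk, h1, h2⟩ := h
  have key : ∀ i < k, a' i = b i := fun i hi => (ha i (by omega)).trans (h1 i hi)
  rcases Nat.lt_or_ge (k + 1) n with hkn | hkn
  · exact Or.inl ⟨k, hk, key, by rw [ha k hkn]; exact h2⟩
  · have := hl k (by omega)
    rcases (show a' k ≤ b k by omega).lt_or_eq with h3 | h3
    · exact Or.inl ⟨k, hk, key, h3⟩
    · refine Or.inr fun i hi => ?_
      rcases (show i ≤ k by omega).lt_or_eq with h4 | h4
      · exact key i h4
      · rw [h4, h3]

/-- Admissibility of the word `v 0, …, v (m - 1)`, viewed as `t⁺` for an admissible word `t`. -/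
structure IsAdmissibleWord (M m : ℕ) (v : ℕ → ℕ) : Prop where
  pos : 0 < m
  le : ∀ i < m, v i ≤ M
  last_pos : ∀ i, i + 1 = m → 1 ≤ v i
  first : M - lowerLast m v 0 < v 0
  shift_le : ∀ i, 1 ≤ i → i < m → prefLe (m - i) (shiftSeq i v) v
  bar_lt : ∀ i, 1 ≤ i → i < m → prefLt (m - i) (barSeq M (shiftSeq i v)) v

namespace IsAdmissibleWord

variable {M m : ℕ} {v : ℕ → ℕ}

theorem bar_prefLt (h : IsAdmissibleWord M m v) {i : ℕ} (hi : 1 ≤ i) (him : i < m) :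
    prefLt i (barSeq M v) (shiftSeq (m - i) v) := by
  obtain ⟨k, hk, h1, h2⟩ := h.bar_lt (m - i) (by omega) (by omega)
  have hle : ∀ j < i, v (m - i + j) ≤ M := fun j hj => h.le _ (by omega)
  have hle' : ∀ j < i, v j ≤ M := fun j hj => h.le _ (by omega)
  simp only [barSeq, shiftSeq] at h1 h2 ⊢
  refine ⟨k, by omega, fun j hj => ?_, ?_⟩
  · have := h1 j hj
    have := hle j (by omega)
    have := hle' j (by omega)
    simp only [barSeq, shiftSeq]; omega
  · have := hle k (by omega)
    have := hle' k (by omega)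
    simp only [barSeq, shiftSeq]; omega

theorem shift_lowerLast_lt (h : IsAdmissibleWord M m v) {i : ℕ} (hi : 1 ≤ i) (him : i < m) :
    prefLt (m - i) (shiftSeq i (lowerLast m v)) v := by
  refine prefLt.trans_prefLe ⟨m - i - 1, by omega, fun j hj => ?_, ?_⟩ (h.shift_le i hi him)
  · simp only [shiftSeq, lowerLast]
    rw [if_neg (by omega)]
  · have := h.last_pos (i + (m - i - 1)) (by omega)
    simp only [shiftSeq, lowerLast]
    rw [if_pos (by omega)]
    omega

theorem bar_shift_lowerLast_le (h : IsAdmissibleWord M m v) {i : ℕ} (hi : 1 ≤ i) (him : i < m) :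
    prefLe (m - i) (barSeq M (shiftSeq i (lowerLast m v))) v := by
  refine (h.bar_lt i hi him).prefLe_of_le_succ (fun j hj => ?_) fun j hj => ?_
  · simp only [barSeq, shiftSeq, lowerLast]
    rw [if_neg (by omega)]
  · simp only [barSeq, shiftSeq, lowerLast]
    rw [if_pos (by omega)]
    omega

theorem lowerLast_lt (h : IsAdmissibleWord M m v) : prefLt m (lowerLast m v) v := by
  have := h.pos
  refine ⟨m - 1, by omega, fun j hj => ?_, ?_⟩
  · simp only [lowerLast]
    rw [if_neg (by omega)]
  · have := h.last_pos (m - 1) (by omega)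
    simp only [lowerLast]
    rw [if_pos (by omega)]
    omega

theorem bar_lowerLast_lt (h : IsAdmissibleWord M m v) :
    prefLt m (barSeq M (lowerLast m v)) v :=
  ⟨0, h.pos, by simp, h.first⟩

theorem bar_first_lt (h : IsAdmissibleWord M m v) : M - v 0 < v 0 := by
  have := h.first
  have : lowerLast m v 0 ≤ v 0 := by unfold lowerLast; split <;> omega
  omega

theorem bar_lt_self (h : IsAdmissibleWord M m v) : prefLt m (barSeq M v) v :=
  ⟨0, h.pos, by simp, h.bar_first_lt⟩

end IsAdmissibleWord

/-- For `v = t⁺`, the sequence starting with `g(t)⁺`, which is `t⁺` followed by the reflection of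
`t`. -/
def doubleWord (M m : ℕ) (v : ℕ → ℕ) : ℕ → ℕ :=
  fun i => if i < m then v i else barSeq M (lowerLast m v) (i - m)

theorem doubleWord_of_lt {M m i : ℕ} {v : ℕ → ℕ} (h : i < m) : doubleWord M m v i = v i := if_pos h

theorem doubleWord_add (M m i : ℕ) (v : ℕ → ℕ) :
    doubleWord M m v (m + i) = barSeq M (lowerLast m v) i := by
  simp [doubleWord]

theorem IsAdmissibleWord.doubleWord {M m : ℕ} {v : ℕ → ℕ} (h : IsAdmissibleWord M m v) :
    IsAdmissibleWord M (2 * m) (doubleWord M m v) := by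
  have hm := h.pos
  have hlow : ∀ i < m, lowerLast m v i ≤ M := fun i hi => by
    have := h.le i hi
    unfold lowerLast; split <;> omega
  have hs : ∀ i, shiftSeq (m + i) (_root_.doubleWord M m v) =
      barSeq M (shiftSeq i (lowerLast m v)) := fun i => by
    funext j
    simp only [shiftSeq, add_assoc, doubleWord_add, barSeq]
  refine ⟨by omega, fun i hi => ?_, fun i hi => ?_, ?_, fun i hi him => ?_, fun i hi him => ?_⟩
  · unfold _root_.doubleWord barSeq
    split
    · exact h.le i ‹_›
    · omega
  · obtain ⟨j, rfl⟩ : ∃ j, i = m + j := ⟨i - m, by omega⟩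
    have h1 := h.last_pos j (by omega)
    have h2 := h.le j (by omega)
    rw [doubleWord_add]
    simp only [barSeq, lowerLast]
    rw [if_pos (by omega)]
    omega
  · simp only [lowerLast]
    rw [if_neg (by omega), doubleWord_of_lt hm]
    exact h.bar_first_lt
  · rcases lt_trichotomy i m with him' | rfl | him'
    · rcases h.shift_le i hi him' with hlt | heq
      · refine Or.inl ((hlt.congr (fun j hj => ?_) fun j hj => ?_).mono (by omega))
        · exact doubleWord_of_lt (by omega)
        · exact doubleWord_of_lt (by omega)
      · left
        have h2 : prefLt (m - i + i) (shiftSeq i (_root_.doubleWord M m v))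
            (_root_.doubleWord M m v) := by
          refine prefLt.prefLt_append (fun j hj => ?_)
            ((h.bar_prefLt hi him').congr (fun j hj => ?_) fun j hj => ?_)
          · rw [doubleWord_of_lt (by omega), ← heq j hj]
            exact doubleWord_of_lt (by omega)
          · simp only [shiftSeq]
            rw [show i + (m - i + j) = m + j by omega, doubleWord_add]
            simp only [barSeq, lowerLast]
            rw [if_neg (by omega)]
          · exact doubleWord_of_lt (by omega)
        exact h2.mono (by omega)
    · have := hs 0
      rw [add_zero] at this
      rw [this]
      exact Or.inl ((h.bar_lowerLast_lt.congr (fun j hj => by simp [shiftSeq, barSeq])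
        fun j hj => doubleWord_of_lt hj).mono (by omega))
    · obtain ⟨j, rfl⟩ : ∃ j, i = m + j := ⟨i - m, by omega⟩
      rw [hs, show 2 * m - (m + j) = m - j by omega]
      exact (h.bar_shift_lowerLast_le (by omega) (by omega)).congr (fun _ _ => rfl)
        fun k hk => doubleWord_of_lt (by omega)
  · rcases lt_trichotomy i m with him' | rfl | him'
    · refine ((h.bar_lt i hi him').congr (fun j hj => ?_) fun j hj => ?_).mono (by omega)
      · simp only [barSeq, shiftSeq]
        rw [doubleWord_of_lt (by omega)]
      · exact doubleWord_of_lt (by omega)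
    · have := hs 0
      rw [add_zero] at this
      rw [this]
      refine (h.lowerLast_lt.congr (fun j hj => ?_) fun j hj => doubleWord_of_lt hj).mono (by omega)
      have := hlow j hj
      simp only [barSeq, shiftSeq, zero_add]; omega
    · obtain ⟨j, rfl⟩ : ∃ j, i = m + j := ⟨i - m, by omega⟩
      rw [hs, show 2 * m - (m + j) = m - j by omega]
      refine (h.shift_lowerLast_lt (i := j) (by omega) (by omega)).congr (fun k hk => ?_)
        fun k hk => doubleWord_of_lt (by omega)
      have := hlow (j + k) (by omega)
      simp only [barSeq, shiftSeq]; omega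


/-- The signs of consecutive blocks: the sign changes after each block flagged by `f`. -/
def signSeq (s : Bool) (f : ℕ → Bool) : ℕ → Bool
  | 0 => s
  | k + 1 => xor (signSeq s f k) (f k)

/-- For `v = t⁺`, one of the words `t⁺`, `t` or their reflections, according to a sign `s`
(`true` for reflected words) and a flag `b` (`true` for `t⁺`). -/
def signedBlock (M m : ℕ) (v : ℕ → ℕ) (s b : Bool) : ℕ → ℕ :=
  if s then barSeq M (if b then v else lowerLast m v) else if b then v else lowerLast m v

/-- The concatenation of the signed blocks with flags `f` and initial sign `s`. -/
def blockSeq (M m : ℕ) (v : ℕ → ℕ) (s : Bool) (f : ℕ → Bool) : ℕ → ℕ :=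
  fun i => signedBlock M m v (signSeq s f (i / m)) (f (i / m)) (i % m)

theorem signSeq_add (s : Bool) (f : ℕ → Bool) (k l : ℕ) :
    signSeq s f (k + l) = signSeq (signSeq s f k) (fun i => f (k + i)) l := by
  induction l with
  | zero => rfl
  | succ l ih => rw [← add_assoc, signSeq, ih, signSeq]

theorem signSeq_not (s : Bool) (f : ℕ → Bool) (k : ℕ) : signSeq (!s) f k = !signSeq s f k := by
  induction k with
  | zero => rfl
  | succ k ih => simp [signSeq, ih]

theorem signSeq_congr {s : Bool} {f g : ℕ → Bool} {k : ℕ} (h : ∀ i < k, f i = g i) :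
    signSeq s f k = signSeq s g k := by
  induction k with
  | zero => rfl
  | succ k ih => rw [signSeq, signSeq, ih fun i hi => h i (by omega), h k (by omega)]

section blockSeq

variable {M m : ℕ} {v : ℕ → ℕ}

theorem blockSeq_apply (s : Bool) (f : ℕ → Bool) (k : ℕ) {i : ℕ} (hi : i < m) :
    blockSeq M m v s f (m * k + i) = signedBlock M m v (signSeq s f k) (f k) i := by
  have h1 : (m * k + i) / m = k := by
    rw [Nat.mul_add_div (by omega), Nat.div_eq_of_lt hi, add_zero]
  have h2 : (m * k + i) % m = i := by
    rw [Nat.mul_add_mod, Nat.mod_eq_of_lt hi]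
  rw [blockSeq, h1, h2]

theorem blockSeq_apply_zero (s : Bool) (f : ℕ → Bool) {i : ℕ} (hi : i < m) :
    blockSeq M m v s f i = signedBlock M m v s (f 0) i := by
  simpa [signSeq] using blockSeq_apply (M := M) (v := v) s f 0 hi

theorem shiftSeq_blockSeq (hm : 0 < m) (s : Bool) (f : ℕ → Bool) (k : ℕ) :
    shiftSeq (m * k) (blockSeq M m v s f) =
      blockSeq M m v (signSeq s f k) (fun i => f (k + i)) := by
  funext i
  simp only [shiftSeq, blockSeq]
  rw [Nat.mul_add_div hm, Nat.mul_add_mod, signSeq_add]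

theorem IsAdmissibleWord.signedBlock_le (h : IsAdmissibleWord M m v) (s b : Bool) {i : ℕ}
    (hi : i < m) : signedBlock M m v s b i ≤ M := by
  have := h.le i hi
  cases s <;> cases b <;> simp [signedBlock, barSeq, lowerLast] <;> try split
  all_goals omega

theorem IsAdmissibleWord.blockSeq_le (h : IsAdmissibleWord M m v) (s : Bool) (f : ℕ → Bool)
    (i : ℕ) : blockSeq M m v s f i ≤ M :=
  h.signedBlock_le _ _ (Nat.mod_lt _ h.pos)

theorem IsAdmissibleWord.bar_blockSeq (h : IsAdmissibleWord M m v) (s : Bool) (f : ℕ → Bool) :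
    barSeq M (blockSeq M m v s f) = blockSeq M m v (!s) f := by
  funext i
  have h1 := h.signedBlock_le false (f (i / m)) (Nat.mod_lt i h.pos)
  simp only [barSeq, blockSeq, signSeq_not]
  generalize signSeq s f (i / m) = s'
  cases s'
  · simp [signedBlock, barSeq]
  · simp only [signedBlock] at h1 ⊢
    simp [barSeq] at h1 ⊢
    omega

theorem IsAdmissibleWord.shift_blockSeq_lt (h : IsAdmissibleWord M m v) (s : Bool) (f : ℕ → Bool)
    {i : ℕ} (hi : 1 ≤ i) (him : i < m) : prefLt m (shiftSeq i (blockSeq M m v s f)) v := by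
  have first : ∀ j < m - i, shiftSeq i (blockSeq M m v s f) j =
      signedBlock M m v s (f 0) (i + j) := fun j hj => blockSeq_apply_zero s f (by omega)
  have second : ∀ j < m, shiftSeq i (blockSeq M m v s f) (m - i + j) =
      signedBlock M m v (xor s (f 0)) (f 1) j := fun j hj => by
    have := blockSeq_apply (M := M) (v := v) s f 1 hj
    rw [shiftSeq, show i + (m - i + j) = m * 1 + j by omega, this]
    rfl
  have extend : (∀ j < m - i, shiftSeq i (blockSeq M m v s f) j = v j) → xor s (f 0) = true →
      prefLt m (shiftSeq i (blockSeq M m v s f)) v := fun heq hs => by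
    have : prefLt (m - i + i) (shiftSeq i (blockSeq M m v s f)) v := by
      refine prefLt.prefLt_append heq ((h.bar_prefLt hi him).congr (fun j hj => ?_) fun _ _ => rfl)
      have := second j (by omega)
      rw [shiftSeq, this, hs]
      have hj' : ¬ j + 1 = m := by omega
      cases f 1 <;> simp [signedBlock, barSeq, lowerLast, hj']
    exact this.mono (by omega)
  cases hs : s <;> cases hf : f 0 <;> subst hs <;> rw [hf] at first second extend
  · exact ((h.shift_lowerLast_lt hi him).congr first fun _ _ => rfl).mono (by omega)
  · rcases h.shift_le i hi him with hlt | heq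
    · exact (hlt.congr first fun _ _ => rfl).mono (by omega)
    · exact extend (fun j hj => (first j hj).trans (heq j hj)) rfl
  · rcases h.bar_shift_lowerLast_le hi him with hlt | heq
    · exact (hlt.congr first fun _ _ => rfl).mono (by omega)
    · exact extend (fun j hj => (first j hj).trans (heq j hj)) rfl
  · exact ((h.bar_lt i hi him).congr first fun _ _ => rfl).mono (by omega)

theorem IsAdmissibleWord.blockSeq_lt_of_flags (h : IsAdmissibleWord M m v) (s : Bool)
    {f F : ℕ → Bool} (hF0 : F 0 = true) (hF1 : F 1 = false) (hF2 : F 2 = false)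
    (hf : f 0 = true → f 1 = false → f 2 = true) :
    seqLt (blockSeq M m v s f) (blockSeq M m v false F) := by
  have hm := h.pos
  have hv : ∀ j < m, blockSeq M m v false F j = v j := fun j hj => by
    rw [blockSeq_apply_zero _ _ hj, hF0]; rfl
  have first : ∀ j < m, blockSeq M m v s f j = signedBlock M m v s (f 0) j := fun j hj =>
    blockSeq_apply_zero s f hj
  have hbar : prefLt m (barSeq M v) (barSeq M (lowerLast m v)) := by
    obtain ⟨k, hk, h1, h2⟩ := h.lowerLast_lt
    have := h.le k hk
    exact ⟨k, hk, fun i hi => by simp only [barSeq, h1 i hi], by simp only [barSeq]; omega⟩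
  cases hs : s <;> subst hs <;> cases hf0 : f 0 <;> rw [hf0] at first
  · exact (h.lowerLast_lt.congr first hv).seqLt
  · cases hf1 : f 1
    · have hf2 := hf hf0 hf1
      refine (prefLt.prefLt_append (j := m * 2) (n := m) (fun j hj => ?_)
        (hbar.congr (fun j hj => ?_) fun j hj => ?_)).seqLt
      · rcases Nat.lt_or_ge j m with hjm | hjm
        · rw [first j hjm, hv j hjm]; rfl
        · obtain ⟨i, rfl⟩ : ∃ i, j = m * 1 + i := ⟨j - m, by omega⟩
          rw [blockSeq_apply _ _ _ (by omega), blockSeq_apply _ _ _ (by omega)]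
          simp [signSeq, hf0, hf1, hF0, hF1]
      · rw [shiftSeq, blockSeq_apply _ _ _ hj]
        simp [signSeq, hf0, hf1, hf2, signedBlock]
      · rw [shiftSeq, blockSeq_apply _ _ _ hj]
        simp [signSeq, hF0, hF1, hF2, signedBlock]
    · refine (prefLt.prefLt_append (j := m * 1) (n := m) (fun j hj => ?_)
        (hbar.congr (fun j hj => ?_) fun j hj => ?_)).seqLt
      · rw [first j (by omega), hv j (by omega)]; rfl
      · rw [shiftSeq, blockSeq_apply _ _ _ hj]
        simp [signSeq, hf0, hf1, signedBlock]
      · rw [shiftSeq, blockSeq_apply _ _ _ hj]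
        simp [signSeq, hF0, hF1, signedBlock]
  · exact (h.bar_lowerLast_lt.congr first hv).seqLt
  · exact (h.bar_lt_self.congr first hv).seqLt

theorem IsAdmissibleWord.isLexUnivoque_blockSeq (h : IsAdmissibleWord M m v) {F : ℕ → Bool}
    (hF0 : F 0 = true) (hF1 : F 1 = false) (hF2 : F 2 = false)
    (hF : ∀ k, 1 ≤ k → F k = true → F (k + 1) = false → F (k + 2) = true) :
    IsLexUnivoque M (blockSeq M m v false F) := by
  have hm := h.pos
  have key : ∀ n, 1 ≤ n → ∀ s : Bool,
      seqLt (shiftSeq n (blockSeq M m v s F)) (blockSeq M m v false F) := fun n hn s => by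
    have hn' : shiftSeq n (blockSeq M m v s F) =
        shiftSeq (n % m) (blockSeq M m v (signSeq s F (n / m)) fun i => F (n / m + i)) := by
      rw [← shiftSeq_blockSeq hm, shiftSeq_shiftSeq, Nat.div_add_mod]
    rw [hn']
    rcases Nat.eq_zero_or_pos (n % m) with h0 | h0
    · rw [h0]
      have hk : 1 ≤ n / m := by
        by_contra hk
        have := Nat.div_add_mod n m
        have hz : n / m = 0 := Nat.lt_one_iff.mp (not_le.mp hk)
        rw [h0, hz, mul_zero] at this
        omega
      have := h.blockSeq_lt_of_flags (signSeq s F (n / m)) (f := fun i => F (n / m + i)) hF0 hF1 hF2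
        (hF _ hk)
      have h0 : ∀ a, shiftSeq 0 a = a := fun a => by funext i; simp [shiftSeq]
      rw [h0]
      exact this
    · refine ((h.shift_blockSeq_lt _ _ h0 (Nat.mod_lt _ hm)).congr (fun _ _ => rfl)
        fun j hj => ?_).seqLt
      rw [blockSeq_apply_zero _ _ hj, hF0]; rfl
  refine ⟨h.blockSeq_le _ _, fun n hn => ⟨key n hn false, ?_⟩⟩
  have : barSeq M (shiftSeq n (blockSeq M m v false F)) =
      shiftSeq n (barSeq M (blockSeq M m v false F)) := rfl
  rw [this, h.bar_blockSeq]
  exact key n hn _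

end blockSeq

theorem IsLexUnivoque.shift_prefLe {M : ℕ} {x : ℕ → ℕ} (h : IsLexUnivoque M x) {n : ℕ}
    (hn : 1 ≤ n) (k : ℕ) : prefLe k (shiftSeq n x) x := (h.2 n hn).1.prefLe k

theorem IsLexUnivoque.lt_two_mul {M : ℕ} {x : ℕ → ℕ} (h : IsLexUnivoque M x) : M < 2 * x 0 := by
  have h1 : ∀ i, x i ≤ x 0 := fun i => by
    rcases Nat.eq_zero_or_pos i with rfl | hi
    · rfl
    · rcases (h.2 i hi).1.prefLe 1 with ⟨k, hk, -, h2⟩ | h2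
      · obtain rfl : k = 0 := by omega
        exact h2.le
      · exact (h2 0 (by omega)).le
  have h2 : ∀ i, 1 ≤ i → M - x i ≤ x 0 := fun i hi => by
    rcases (h.2 i hi).2.prefLe 1 with ⟨k, hk, -, h2⟩ | h2
    · obtain rfl : k = 0 := by omega
      exact h2.le
    · exact (h2 0 (by omega)).le
  by_contra hlt
  obtain ⟨k, -, hk⟩ := (h.2 1 le_rfl).1
  have h3 := h1 k
  have h4 := h2 (1 + k) (by omega)
  have h5 : shiftSeq 1 x k = x (1 + k) := rfl
  omega

/-- The word up to the first disagreement of two lexicographically univoque sequences. -/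
theorem IsLexUnivoque.isAdmissibleWord {M N : ℕ} {c d : ℕ → ℕ} (hc : IsLexUnivoque M c)
    (hd : IsLexUnivoque M d) (heq : ∀ i < N, c i = d i) (hlt : c N < d N) :
    IsAdmissibleWord M (N + 1) d := by
  refine ⟨by omega, fun i _ => hd.1 i, fun i hi => ?_, ?_, fun i hi _ => hd.shift_prefLe hi _,
    fun i hi him => ?_⟩
  · obtain rfl : i = N := by omega
    omega
  · have h1 := hc.lt_two_mul
    have h2 := hd.lt_two_mul
    unfold lowerLast
    split
    · obtain rfl : N = 0 := by omega
      omega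
    · omega
  · refine prefLt.trans_prefLe (b := barSeq M (shiftSeq i c)) ⟨N - i, by omega, fun j hj => ?_, ?_⟩
      (((hc.2 i hi).2.prefLe _).congr (fun _ _ => rfl) fun j hj => (heq j (by omega)).symm)
    · simp only [barSeq, shiftSeq, heq (i + j) (by omega)]
    · have := hd.1 N
      simp only [barSeq, shiftSeq, show i + (N - i) = N by omega]
      omega

/-- The sequence `v \bar v v \bar v …`. -/
def alternatingSeq (M m : ℕ) (v : ℕ → ℕ) : ℕ → ℕ := fun i =>
  if (i / m) % 2 = 0 then v (i % m) else M - v (i % m)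

theorem alternatingSeq_of_lt {M m i : ℕ} {v : ℕ → ℕ} (h : i < m) :
    alternatingSeq M m v i = v i := by
  simp [alternatingSeq, Nat.div_eq_of_lt h, Nat.mod_eq_of_lt h]

theorem alternatingSeq_add {M m i : ℕ} {v : ℕ → ℕ} (hm : 0 < m) (hv : ∀ i < m, v i ≤ M) :
    M - alternatingSeq M m v (m + i) = alternatingSeq M m v i := by
  have h1 := hv (i % m) (Nat.mod_lt _ hm)
  simp only [alternatingSeq, Nat.add_mod_left, Nat.add_div_left i hm]
  split <;> split <;> omega

theorem alternatingSeq_add_two_mul {M m i : ℕ} {v : ℕ → ℕ} (hm : 0 < m) :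
    alternatingSeq M m v (2 * m + i) = alternatingSeq M m v i := by
  have h1 : (2 * m + i) / m = i / m + 2 := by
    rw [mul_comm, Nat.mul_add_div hm, add_comm]
  simp only [alternatingSeq, h1, Nat.add_mod_right]
  rw [mul_comm, Nat.mul_add_mod]

/-- A lexicographically univoque sequence that starts with `t⁺` or with something larger also
starts with `g(t)⁺` or with something larger. -/
theorem IsLexUnivoque.doubleWord_prefLe {M m : ℕ} {v c : ℕ → ℕ} (hc : IsLexUnivoque M c)
    (hv : IsAdmissibleWord M m v) (h : prefLe m v c) : prefLe (2 * m) (doubleWord M m v) c := by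
  have hm := hv.pos
  rcases h with hlt | heq
  · exact Or.inl ((hlt.congr (fun i hi => doubleWord_of_lt hi) fun _ _ => rfl).mono (by omega))
  set g := alternatingSeq M m v with hg
  have hgm : ∀ i, M - g (m + i) = g i := fun i => alternatingSeq_add hm hv.le
  have hg2 : ∀ i, g (2 * m + i) = g i := fun i => alternatingSeq_add_two_mul hm
  have hle : ∀ i, g i ≤ M := fun i => (hgm i) ▸ Nat.sub_le _ _
  have hne : c ≠ g := by
    rintro hcg
    have := (hc.2 (2 * m) (by omega)).1
    rw [show shiftSeq (2 * m) c = c from funext fun i => by rw [shiftSeq, hcg, hg2]] at this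
    exact seqLt_irrefl _ this
  have hfirst : ∀ i < m, c i = g i := fun i hi => by
    rw [← heq i hi, hg, alternatingSeq_of_lt hi]
  rcases seqLt_trichotomy hne with ⟨N, hN, hN'⟩ | ⟨N, hN, hN'⟩
  · exfalso
    have hmN : m ≤ N := by
      by_contra hlt
      exact hN'.ne (hfirst N (by omega))
    refine seqLt_irrefl c (seqLt_trans ?_ (hc.2 m hm).2)
    have h1 := hgm (N - m)
    have h2 := hle N
    rw [Nat.add_sub_cancel' hmN] at h1
    refine ⟨N - m, fun j hj => ?_, ?_⟩
    · simp only [barSeq, shiftSeq]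
      rw [hN (m + j) (by omega), hgm, hN j (by omega)]
    · simp only [barSeq, shiftSeq, Nat.add_sub_cancel' hmN]
      rw [hN (N - m) (by omega)]
      omega
  · have hmN : m ≤ N := by
      by_contra hlt
      exact hN'.ne' (hfirst N (by omega))
    have hN2 : N < 2 * m := by
      by_contra hlt
      refine seqLt_irrefl c (seqLt_trans ?_ (hc.2 (2 * m) (by omega)).1)
      have h1 := hg2 (N - 2 * m)
      rw [Nat.add_sub_cancel' (not_lt.mp hlt)] at h1
      refine ⟨N - 2 * m, fun j hj => ?_, ?_⟩
      · simp only [shiftSeq]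
        rw [← hN (2 * m + j) (by omega), hg2, hN j (by omega)]
      · simp only [shiftSeq, Nat.add_sub_cancel' (not_lt.mp hlt)]
        rw [← hN (N - 2 * m) (by omega)]
        omega
    refine prefLt.prefLe_of_le_succ (a := g) ⟨N, hN2, hN, hN'⟩ (fun i hi => ?_) fun i hi => ?_
    · by_cases him : i < m
      · rw [doubleWord_of_lt him, hg, alternatingSeq_of_lt him]
      · obtain ⟨j, rfl⟩ : ∃ j, i = m + j := ⟨i - m, by omega⟩
        have h1 := hgm j
        have h2 := hle (m + j)
        have hj : g j = v j := alternatingSeq_of_lt (by omega)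
        rw [doubleWord_add, barSeq, lowerLast, if_neg (by omega)]
        omega
    · obtain ⟨j, rfl⟩ : ∃ j, i = m + j := ⟨i - m, by omega⟩
      have h1 := hgm j
      have h2 := hle (m + j)
      have h3 := hv.last_pos j (by omega)
      have hj : g j = v j := alternatingSeq_of_lt (by omega)
      rw [doubleWord_add, barSeq, lowerLast, if_pos (by omega)]
      omega

/-- Between lexicographically univoque sequences `c < d < e` lies a whole cylinder determined by an
admissible word. -/
theorem IsLexUnivoque.exists_isAdmissibleWord {M : ℕ} {c d e : ℕ → ℕ} (hc : IsLexUnivoque M c)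
    (hd : IsLexUnivoque M d) (hcd : seqLt c d) (hde : seqLt d e) :
    ∃ m v, IsAdmissibleWord M m v ∧ prefLt m c v ∧ prefLt m v e := by
  obtain ⟨N, hN, hN'⟩ := hcd
  by_contra! hno
  have chain : ∀ n, ∃ m v, n ≤ m ∧ IsAdmissibleWord M m v ∧ prefLt m c v ∧ prefLe m v d := by
    intro n
    induction n with
    | zero => exact ⟨N + 1, d, by omega, hc.isAdmissibleWord hd hN hN', ⟨N, by omega, hN, hN'⟩,
        Or.inr fun _ _ => rfl⟩
    | succ n ih =>
      obtain ⟨m, v, hnm, hv, hcv, hvd⟩ := ih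
      have := hv.pos
      exact ⟨2 * m, doubleWord M m v, by omega, hv.doubleWord, (hcv.congr (fun _ _ => rfl)
        fun i hi => doubleWord_of_lt hi).mono (by omega), hd.doubleWord_prefLe hv hvd⟩
  obtain ⟨K, hK, hK'⟩ := hde
  obtain ⟨m, v, hKm, hv, hcv, hvd⟩ := chain (K + 1)
  refine hno m v hv hcv ?_
  rcases hvd with ⟨k, hk, h1, h2⟩ | h
  · exact prefLt.trans_prefLe ⟨k, hk, h1, h2⟩ (Or.inl ⟨K, by omega, hK, hK'⟩)
  · exact ⟨K, by omega, fun i hi => (h i (by omega)).trans (hK i hi), by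
      rw [h K (by omega)]; exact hK'⟩


theorem shiftSeq_zero (a : ℕ → ℕ) : shiftSeq 0 a = a := by
  funext i; simp [shiftSeq]

theorem barSeq_barSeq {M : ℕ} {a : ℕ → ℕ} (h : ∀ i, a i ≤ M) : barSeq M (barSeq M a) = a := by
  funext i
  have := h i
  simp only [barSeq]
  omega

section piQ

variable {M : ℕ} {q : ℝ}

theorem summable_piQ (hq : 1 < q) {d : ℕ → ℕ} (hd : ∀ i, d i ≤ M) :
    Summable fun i => (d i : ℝ) / q ^ (i + 1) := by
  have hq0 : 0 < q := by linarith
  refine Summable.of_nonneg_of_le (fun i => by positivity) (fun i => ?_)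
    ((summable_geometric_of_lt_one (by positivity) (inv_lt_one_of_one_lt₀ hq)).mul_left (M : ℝ))
  have h1 : (d i : ℝ) ≤ M := by exact_mod_cast hd i
  have h2 : q ^ i ≤ q ^ (i + 1) := pow_le_pow_right₀ hq.le (by omega)
  rw [inv_pow, ← div_eq_mul_inv]
  gcongr

theorem piQ_nonneg (hq : 1 < q) (d : ℕ → ℕ) : 0 ≤ piQ q d := by
  have hq0 : 0 < q := by linarith
  exact tsum_nonneg fun i => by positivity

theorem piQ_const (hq : 1 < q) (M : ℕ) : piQ q (fun _ => M) = M / (q - 1) := by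
  have hq0 : 0 < q := by linarith
  have h1 : q - 1 ≠ 0 := by linarith
  have h2 : ∀ i : ℕ, (M : ℝ) / q ^ (i + 1) = M / q * q⁻¹ ^ i := fun i => by
    rw [pow_succ, inv_pow]; field_simp
  rw [piQ, tsum_congr h2, tsum_mul_left,
    tsum_geometric_of_lt_one (by positivity) (inv_lt_one_of_one_lt₀ hq)]
  field_simp

theorem piQ_le (hq : 1 < q) {d : ℕ → ℕ} (hd : ∀ i, d i ≤ M) : piQ q d ≤ M / (q - 1) := by
  have hq0 : 0 < q := by linarith
  rw [← piQ_const hq M]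
  refine (summable_piQ hq hd).tsum_le_tsum (fun i => ?_) (summable_piQ hq fun _ => le_rfl)
  have h1 : (d i : ℝ) ≤ M := by exact_mod_cast hd i
  gcongr

theorem piQ_barSeq (hq : 1 < q) {d : ℕ → ℕ} (hd : ∀ i, d i ≤ M) :
    piQ q (barSeq M d) = M / (q - 1) - piQ q d := by
  have hbar : ∀ i, barSeq M d i ≤ M := fun i => Nat.sub_le _ _
  rw [eq_sub_iff_add_eq, ← piQ_const hq M, piQ, piQ,
    ← (summable_piQ hq hbar).tsum_add (summable_piQ hq hd)]
  refine tsum_congr fun i => ?_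
  simp only [barSeq]
  rw [Nat.cast_sub (hd i)]
  ring

theorem piQ_eq_shift (hq : 1 < q) {d : ℕ → ℕ} (hd : ∀ i, d i ≤ M) :
    q * piQ q d = d 0 + piQ q (shiftSeq 1 d) := by
  have hq0 : q ≠ 0 := by linarith
  rw [piQ, (summable_piQ hq hd).tsum_eq_zero_add, piQ, mul_add, ← tsum_mul_left]
  congr 1
  · simp; field_simp
  · refine tsum_congr fun i => ?_
    simp only [shiftSeq]
    rw [add_comm 1 i, pow_succ]
    field_simp

/-- Comparison of two digit sequences that agree up to some position. -/
theorem piQ_sub (hq : 1 < q) {N : ℕ} {b x : ℕ → ℕ} (hb : ∀ i, b i ≤ M) (hx : ∀ i, x i ≤ M)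
    (h : ∀ i < N, b i = x i) :
    q ^ (N + 1) * (piQ q x - piQ q b) =
      (x N : ℝ) - b N + (piQ q (shiftSeq (N + 1) x) - piQ q (shiftSeq (N + 1) b)) := by
  induction N generalizing b x with
  | zero =>
    rw [zero_add, pow_one, mul_sub, piQ_eq_shift hq hx, piQ_eq_shift hq hb]
    ring
  | succ N ih =>
    have := ih (b := shiftSeq 1 b) (x := shiftSeq 1 x) (fun i => hb _) (fun i => hx _)
      fun i hi => h (1 + i) (by omega)
    have hN : ∀ a : ℕ → ℕ, shiftSeq 1 a N = a (N + 1) := fun a => by rw [shiftSeq, add_comm]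
    rw [shiftSeq_shiftSeq, shiftSeq_shiftSeq, add_comm 1 (N + 1), hN, hN] at this
    rw [← this, pow_succ (n := N + 1), mul_assoc, mul_sub q, piQ_eq_shift hq hx,
      piQ_eq_shift hq hb, h 0 (by omega)]
    ring

theorem piQ_le_one_of_seqLe (hq : 1 < q) {b x : ℕ → ℕ} (hb : ∀ i, b i ≤ M) (hx : ∀ i, x i ≤ M)
    (hx1 : piQ q x = 1) (h : ∀ n, seqLe (shiftSeq n b) x) : piQ q b ≤ 1 := by
  have hq0 : 0 < q := by linarith
  set K : ℝ := M / (q - 1)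
  have hK : 0 ≤ K := (piQ_nonneg hq _).trans (piQ_le hq hb)
  have key : ∀ j n, piQ q (shiftSeq n b) - 1 ≤ K / q ^ j := by
    intro j
    induction j with
    | zero =>
      intro n
      have := piQ_le hq (d := shiftSeq n b) fun i => hb _
      simp only [pow_zero, div_one]
      linarith
    | succ j ih =>
      intro n
      rcases h n with ⟨N, hN, hN'⟩ | heq
      · have h1 := piQ_sub hq (b := shiftSeq n b) (fun i => hb _) hx hN
        rw [shiftSeq_shiftSeq, hx1] at h1
        have h2 := ih (n + (N + 1))
        have h3 := piQ_nonneg hq (shiftSeq (N + 1) x)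
        have h4 : (shiftSeq n b N : ℝ) + 1 ≤ x N := by exact_mod_cast hN'
        have h5 : q ^ (N + 1) * (piQ q (shiftSeq n b) - 1) ≤ K / q ^ j := by linarith
        have h6 : q ≤ q ^ (N + 1) := le_self_pow₀ hq.le (by omega)
        rcases le_total (piQ q (shiftSeq n b) - 1) 0 with h7 | h7
        · exact h7.trans (by positivity)
        · have h8 : q * (piQ q (shiftSeq n b) - 1) ≤ K / q ^ j :=
            (mul_le_mul_of_nonneg_right h6 h7).trans h5
          rw [pow_succ, ← div_div, le_div_iff₀ hq0]
          linarith
      · rw [heq, hx1, sub_self]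
        positivity
  have hlim : Tendsto (fun j : ℕ => K / q ^ j) atTop (nhds 0) :=
    tendsto_const_nhds.div_atTop (tendsto_pow_atTop_atTop_of_one_lt hq)
  have := ge_of_tendsto' hlim fun j => key j 0
  rw [shiftSeq_zero] at this
  linarith

theorem piQ_add_le_one (hq : 1 < q) {N : ℕ} {b x : ℕ → ℕ} (hb : ∀ i, b i ≤ M)
    (hx : ∀ i, x i ≤ M) (hx1 : piQ q x = 1) (h : ∀ n, seqLe (shiftSeq n b) x)
    (hN : ∀ i < N, b i = x i) (hlt : b N < x N) :
    piQ q b + piQ q (shiftSeq (N + 1) x) / q ^ (N + 1) ≤ 1 := by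
  have hq0 : 0 < q := by linarith
  have h1 := piQ_sub hq hb hx hN
  have h2 : piQ q (shiftSeq (N + 1) b) ≤ 1 := piQ_le_one_of_seqLe hq (fun i => hb _) hx hx1
    fun n => by rw [shiftSeq_shiftSeq]; exact h _
  have h3 : (b N : ℝ) + 1 ≤ x N := by exact_mod_cast hlt
  have h4 : piQ q (shiftSeq (N + 1) x) / q ^ (N + 1) ≤ 1 - piQ q b := by
    rw [div_le_iff₀ (by positivity), mul_comm, ← hx1, h1]
    linarith
  linarith

theorem one_lt_div_sub_one (hq : 1 < q) (hqM : q < M + 1) : 1 < M / (q - 1) := by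
  rw [one_lt_div (by linarith)]
  linarith

namespace IsLexUnivoque

variable {x : ℕ → ℕ}

theorem le_piQ_shift (h : IsLexUnivoque M x) (hq : 1 < q) (hx1 : piQ q x = 1) {k : ℕ}
    (hk : 1 ≤ k) : M / (q - 1) - 1 ≤ piQ q (shiftSeq k x) := by
  have h1 := piQ_barSeq hq (d := shiftSeq k x) fun i => h.1 _
  have h2 : piQ q (barSeq M (shiftSeq k x)) ≤ 1 := by
    refine piQ_le_one_of_seqLe (M := M) hq (fun i => Nat.sub_le _ _) h.1 hx1 fun n => Or.inl ?_
    have := (h.2 (k + n) (by omega)).2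
    rwa [← shiftSeq_shiftSeq] at this
  linarith

theorem piQ_shift_pos (h : IsLexUnivoque M x) (hq : 1 < q) (hqM : q < M + 1) (hx1 : piQ q x = 1)
    {k : ℕ} (hk : 1 ≤ k) : 0 < piQ q (shiftSeq k x) := by
  have := h.le_piQ_shift hq hx1 hk
  have := one_lt_div_sub_one hq hqM
  linarith

theorem piQ_lt_one (h : IsLexUnivoque M x) (hq : 1 < q) (hqM : q < M + 1) (hx1 : piQ q x = 1)
    {b : ℕ → ℕ} (hb : ∀ i, b i ≤ M) (hlt : ∀ n, seqLt (shiftSeq n b) x) : piQ q b < 1 := by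
  have hq0 : 0 < q := by linarith
  obtain ⟨N, hN, hN'⟩ := hlt 0
  rw [shiftSeq_zero] at hN hN'
  have h1 := piQ_add_le_one hq hb h.1 hx1 (fun n => Or.inl (hlt n)) hN hN'
  have h2 := h.piQ_shift_pos hq hqM hx1 (k := N + 1) (by omega)
  have : 0 < piQ q (shiftSeq (N + 1) x) / q ^ (N + 1) := by positivity
  linarith

theorem mem_univBases (h : IsLexUnivoque M x) (hq : 1 < q) (hqM : q < M + 1)
    (hx1 : piQ q x = 1) : q ∈ UnivBases M := by
  refine ⟨hq, hqM.le, x, ⟨h.1, hx1⟩, fun e ⟨he, he1⟩ => ?_⟩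
  by_contra hne
  rcases seqLt_trichotomy hne with ⟨N, hN, hN'⟩ | ⟨N, hN, hN'⟩
  · have h1 := piQ_sub hq he h.1 hN
    rw [hx1, he1, sub_self, mul_zero] at h1
    have h2 := piQ_le hq (d := shiftSeq (N + 1) e) fun i => he _
    have h3 : (e N : ℝ) + 1 ≤ x N := by exact_mod_cast hN'
    have h4 := piQ_barSeq hq (d := shiftSeq (N + 1) x) fun i => h.1 _
    have h5 : piQ q (barSeq M (shiftSeq (N + 1) x)) < 1 := by
      refine h.piQ_lt_one hq hqM hx1 (fun i => Nat.sub_le _ _) fun n => ?_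
      have := (h.2 (N + 1 + n) (by omega)).2
      rwa [← shiftSeq_shiftSeq] at this
    linarith
  · have h1 := piQ_sub hq h.1 he hN
    rw [hx1, he1, sub_self, mul_zero] at h1
    have h2 := piQ_nonneg hq (shiftSeq (N + 1) e)
    have h3 : (x N : ℝ) + 1 ≤ e N := by exact_mod_cast hN'
    have h5 : piQ q (shiftSeq (N + 1) x) < 1 := by
      refine h.piQ_lt_one hq hqM hx1 (fun i => h.1 _) fun n => ?_
      rw [shiftSeq_shiftSeq]
      exact (h.2 (N + 1 + n) (by omega)).1
    linarith

end IsLexUnivoque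

/-- The remainders of the greedy algorithm in base `q`. -/
def greedyRem (M : ℕ) (q y : ℝ) : ℕ → ℝ
  | 0 => y
  | n + 1 => q * greedyRem M q y n - (min M ⌊q * greedyRem M q y n⌋₊ : ℕ)

theorem greedyRem_mem (hq : 1 < q) (hqM : q ≤ M + 1) {y : ℝ} (hy : y ∈ Icc 0 (M / (q - 1)))
    (n : ℕ) : greedyRem M q y n ∈ Icc 0 (M / (q - 1)) := by
  have hq1 : 0 < q - 1 := by linarith
  induction n with
  | zero => exact hy
  | succ n ih =>
    obtain ⟨h0, h1⟩ := ih
    rw [greedyRem]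
    set r := greedyRem M q y n
    have h2 : 0 ≤ q * r := mul_nonneg (by linarith) h0
    have hfl := Nat.floor_le h2
    rcases le_total ⌊q * r⌋₊ M with hle | hle
    · rw [min_eq_right hle]
      refine ⟨by linarith, ?_⟩
      have h3 : 1 ≤ M / (q - 1) := by rw [one_le_div hq1]; linarith
      linarith [Nat.lt_floor_add_one (q * r)]
    · rw [min_eq_left hle]
      have h3 : (M : ℝ) ≤ ⌊q * r⌋₊ := by exact_mod_cast hle
      refine ⟨by linarith, ?_⟩
      rw [le_div_iff₀ hq1] at h1 ⊢
      nlinarith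

theorem exists_isExpansion (hq : 1 < q) (hqM : q ≤ M + 1) {y : ℝ}
    (hy : y ∈ Icc 0 (M / (q - 1))) : ∃ e, IsExpansion M q y e := by
  have hq0 : 0 < q := by linarith
  set e : ℕ → ℕ := fun n => min M ⌊q * greedyRem M q y n⌋₊ with he
  have heM : ∀ i, e i ≤ M := fun i => min_le_left _ _
  refine ⟨e, heM, ?_⟩
  have hsum : ∀ n, ∑ i ∈ Finset.range n, (e i : ℝ) / q ^ (i + 1) =
      y - greedyRem M q y n / q ^ n := by
    intro n
    induction n with
    | zero => simp [greedyRem]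
    | succ n ih =>
      rw [Finset.sum_range_succ, ih, greedyRem, pow_succ]
      field_simp
      simp only [he]
      ring_nf
  have hlim : Tendsto (fun n => greedyRem M q y n / q ^ n) atTop (nhds 0) := by
    refine squeeze_zero (g := fun n => M / (q - 1) / q ^ n)
      (fun n => div_nonneg (greedyRem_mem hq hqM hy n).1 (by positivity)) (fun n => ?_)
      (tendsto_const_nhds.div_atTop (tendsto_pow_atTop_atTop_of_one_lt hq))
    have := (greedyRem_mem hq hqM hy n).2
    gcongr
  refine tendsto_nhds_unique (summable_piQ hq heM).hasSum.tendsto_sum_nat ?_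
  simp only [hsum]
  simpa using hlim.const_sub y

/-- A digit of a unique expansion can only be increased if the remainder is too small. -/
theorem piQ_shift_lt_one (hq : 1 < q) (hqM : q ≤ M + 1) {d : ℕ → ℕ} (hd : d ∈ UnivSeqs M q)
    {k : ℕ} (hk : d k < M) : piQ q (shiftSeq (k + 1) d) < 1 := by
  by_contra! hge
  have hq0 : 0 < q := by linarith
  obtain ⟨f, hf, hf1⟩ := exists_isExpansion hq hqM (y := piQ q (shiftSeq (k + 1) d) - 1)
    ⟨by linarith, by linarith [piQ_le hq (d := shiftSeq (k + 1) d) fun i => hd.1 _]⟩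
  set e : ℕ → ℕ := fun i => if i < k then d i else if i = k then d k + 1 else f (i - (k + 1))
    with he
  have hek : e k = d k + 1 := by simp [he]
  have heM : ∀ i, e i ≤ M := fun i => by
    have := hd.1 i
    have := hf (i - (k + 1))
    simp only [he]
    split
    · assumption
    · split <;> omega
  have hes : shiftSeq (k + 1) e = f := by
    funext i
    simp only [shiftSeq, he]
    rw [if_neg (by omega), if_neg (by omega), Nat.add_sub_cancel_left]
  have h1 := piQ_sub (N := k) hq hd.1 heM fun i hi => by simp [he, hi]
  rw [hes, hf1, hek] at h1
  push_cast at h1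
  have h2 : piQ q e = piQ q d := by
    have h3 : q ^ (k + 1) * (piQ q e - piQ q d) = 0 := by rw [h1]; ring
    rcases mul_eq_zero.mp h3 with h | h
    · exact absurd h (by positivity)
    · linarith
  have := congrFun (hd.2 e ⟨heM, h2⟩) k
  omega

theorem seqLt_of_piQ_lt (hq : 1 < q) (hqM : q ≤ M + 1) {a c : ℕ → ℕ} (hc : c ∈ UnivSeqs M q)
    (ha : ∀ i, a i ≤ M) (h : piQ q a < piQ q c) : seqLt a c := by
  have hq0 : 0 < q := by linarith
  have hne : a ≠ c := by rintro rfl; exact lt_irrefl _ h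
  refine (seqLt_trichotomy hne).resolve_right ?_
  rintro ⟨N, hN, hN'⟩
  have h1 := piQ_sub hq hc.1 ha hN
  have h2 := piQ_shift_lt_one hq hqM hc (hN'.trans_le (ha N))
  have h3 := piQ_nonneg hq (shiftSeq (N + 1) a)
  have h4 : (c N : ℝ) + 1 ≤ a N := by exact_mod_cast hN'
  have h5 : q ^ (N + 1) * (piQ q a - piQ q c) < 0 :=
    mul_neg_of_pos_of_neg (by positivity) (by linarith)
  linarith

theorem barSeq_mem_univSeqs (hq : 1 < q) {c : ℕ → ℕ} (hc : c ∈ UnivSeqs M q) :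
    barSeq M c ∈ UnivSeqs M q := by
  refine ⟨fun i => Nat.sub_le _ _, fun e ⟨he, he1⟩ => ?_⟩
  have := hc.2 (barSeq M e) ⟨fun i => Nat.sub_le _ _, by
    rw [piQ_barSeq hq he, he1, piQ_barSeq hq hc.1]; ring⟩
  rw [← this, barSeq_barSeq he]

/-- The lexicographic characterization of univoque bases, in one direction. -/
theorem exists_isLexUnivoque (hq : q ∈ UnivBases M) (hqM : q < M + 1) :
    ∃ c, IsLexUnivoque M c ∧ piQ q c = 1 := by
  obtain ⟨hq1, hqM', c, ⟨hcM, hc1⟩, huniq⟩ := hq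
  have hc : c ∈ UnivSeqs M q := ⟨hcM, fun e he => huniq e (hc1 ▸ he)⟩
  refine ⟨c, ⟨hcM, ?_⟩, hc1⟩
  have of_lt : ∀ d ∈ UnivSeqs M q, ∀ k, d k < M → seqLt (shiftSeq (k + 1) d) c :=
    fun d hd k hk => seqLt_of_piQ_lt hq1 hqM' hc (fun i => hd.1 _)
      (hc1 ▸ piQ_shift_lt_one hq1 hqM' hd hk)
  have hshift : seqLt (shiftSeq 1 c) c := by
    rcases (hcM 0).lt_or_eq with h0 | h0
    · exact of_lt c hc 0 h0
    · have hex : ∃ i, c i ≠ M := by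
        by_contra! hall
        rw [show c = fun _ => M from funext hall, piQ_const hq1,
          div_eq_one_iff_eq (by linarith)] at hc1
        linarith
      classical
      have hmin : ∀ i < Nat.find hex, c i = M := fun i hi => by
        simpa using Nat.find_min hex hi
      have hspec := Nat.find_spec hex
      set n := Nat.find hex
      have hn : n ≠ 0 := by
        intro hn
        rw [hn] at hspec
        exact hspec h0
      have h1 := hcM n
      refine ⟨n - 1, fun i hi => ?_, ?_⟩
      · rw [shiftSeq, hmin _ (by omega), hmin _ (by omega)]
      · rw [shiftSeq, show 1 + (n - 1) = n by omega, hmin (n - 1) (by omega)]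
        omega
  have key : ∀ d ∈ UnivSeqs M q, seqLt (shiftSeq 1 d) c →
      ∀ k, seqLt (shiftSeq (k + 1) d) c := by
    intro d hd hd1 k
    induction k with
    | zero => exact hd1
    | succ k ih =>
      rcases (hd.1 (k + 1)).lt_or_eq with h0 | h0
      · exact of_lt d hd _ h0
      · obtain ⟨N, hN, hN'⟩ := ih
        have hN0 : N ≠ 0 := by
          rintro rfl
          have := hcM 0
          simp only [shiftSeq, add_zero] at hN'
          omega
        refine seqLt_trans ⟨N - 1, fun i hi => ?_, ?_⟩ hshift
        · have := hN (i + 1) (by omega)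
          simp only [shiftSeq] at this ⊢
          rw [show k + 1 + 1 + i = k + 1 + (i + 1) by omega, this, add_comm]
        · simp only [shiftSeq] at hN' ⊢
          rwa [show k + 1 + 1 + (N - 1) = k + 1 + N by omega, show 1 + (N - 1) = N by omega]
  have hbar := barSeq_mem_univSeqs hq1 hc
  have hbar1 : seqLt (shiftSeq 1 (barSeq M c)) c := by
    refine of_lt _ hbar 0 ?_
    by_contra hge
    have h0 : c 0 = 0 := by
      have := hcM 0
      simp only [barSeq] at hge
      have := hbar.1 0
      by_contra h0
      omega
    have hM : 0 < M := by
      have : (0 : ℝ) < M := by linarith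
      exact_mod_cast this
    have h1 := piQ_shift_lt_one hq1 hqM' hc (k := 0) (by omega)
    have h2 := piQ_eq_shift hq1 hcM
    rw [h0, hc1] at h2
    norm_num at h1 h2
    linarith
  intro n hn
  obtain ⟨k, rfl⟩ : ∃ k, n = k + 1 := ⟨n - 1, by omega⟩
  exact ⟨key c hc hshift k, key _ hbar hbar1 k⟩

end piQ

section bases

variable {M : ℕ}

theorem piQ_lt_piQ_of_lt {r s : ℝ} (hr : 1 < r) (hrs : r < s) {d : ℕ → ℕ} (hd : ∀ i, d i ≤ M)
    (hd0 : 0 < d 0) : piQ s d < piQ r d := by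
  have hr0 : 0 < r := by linarith
  refine Summable.tsum_lt_tsum (i := 0) (fun i => ?_) ?_ (summable_piQ (hr.trans hrs) hd)
    (summable_piQ hr hd)
  · dsimp only
    gcongr
  · simp only [zero_add, pow_one]
    gcongr

theorem IsLexUnivoque.seqLt_of_lt {r s : ℝ} (hr : 1 < r) (hrs : r < s) {c d : ℕ → ℕ}
    (hc : IsLexUnivoque M c) (hd : IsLexUnivoque M d) (hc1 : piQ r c = 1) (hd1 : piQ s d = 1) :
    seqLt c d := by
  have hd0 : 0 < d 0 := by have := hd.lt_two_mul; omega
  have h1 := piQ_lt_piQ_of_lt hr hrs hd.1 hd0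
  have hne : c ≠ d := by
    rintro rfl
    linarith
  refine (seqLt_trichotomy hne).resolve_right fun hlt => ?_
  have h2 : piQ r d ≤ 1 := piQ_le_one_of_seqLe hr hd.1 hc.1 hc1 fun n => by
    rcases Nat.eq_zero_or_pos n with rfl | hn
    · rw [shiftSeq_zero]; exact Or.inl hlt
    · exact Or.inl (seqLt_trans (hd.2 n hn).1 hlt)
  linarith

theorem exists_piQ_lipschitz (M : ℕ) {r : ℝ} (hr : 1 < r) :
    ∃ C : ℝ, 0 < C ∧ ∀ x : ℕ → ℕ, (∀ i, x i ≤ M) → ∀ β β' : ℝ, r ≤ β → r ≤ β' →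
      |piQ β x - piQ β' x| ≤ C * |β - β'| := by
  have hr0 : 0 < r := by linarith
  have hu : r⁻¹ < 1 := inv_lt_one_of_one_lt₀ hr
  have hu0 : 0 < r⁻¹ := by positivity
  have hs : Summable fun i : ℕ => (M : ℝ) * (((i : ℝ) + 1) * r⁻¹ ^ i) := by
    refine Summable.mul_left _ ?_
    have h1 := summable_pow_mul_geometric_of_norm_lt_one 1 (r := r⁻¹)
      (by rwa [Real.norm_of_nonneg hu0.le])
    have h2 := summable_geometric_of_lt_one hu0.le hu
    refine (h1.add h2).congr fun i => ?_
    ring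
  refine ⟨∑' i : ℕ, (M : ℝ) * (((i : ℝ) + 1) * r⁻¹ ^ i) + 1, ?_, fun x hx β β' hβ hβ' => ?_⟩
  · have : 0 ≤ ∑' i : ℕ, (M : ℝ) * (((i : ℝ) + 1) * r⁻¹ ^ i) := tsum_nonneg fun i => by positivity
    linarith
  have hβ1 : 1 < β := hr.trans_le hβ
  have hβ1' : 1 < β' := hr.trans_le hβ'
  have hinv : |β⁻¹ - β'⁻¹| ≤ |β - β'| := by
    rw [inv_sub_inv (by linarith) (by linarith), abs_div, abs_sub_comm β' β]
    refine div_le_self (abs_nonneg _) ?_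
    rw [abs_of_pos (by positivity)]
    nlinarith
  rw [piQ, piQ, ← (summable_piQ hβ1 hx).tsum_sub (summable_piQ hβ1' hx)]
  have hb := tsum_of_norm_bounded (hs.hasSum.mul_right |β - β'|)
    (f := fun i => (x i : ℝ) / β ^ (i + 1) - (x i : ℝ) / β' ^ (i + 1)) fun i => by
      have h1 : (x i : ℝ) / β ^ (i + 1) - (x i : ℝ) / β' ^ (i + 1) =
          x i * (β⁻¹ ^ (i + 1) - β'⁻¹ ^ (i + 1)) := by
        rw [inv_pow, inv_pow]; ring
      have h2 : (x i : ℝ) ≤ M := by exact_mod_cast hx i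
      have h3 := abs_pow_sub_pow_le β⁻¹ β'⁻¹ (i + 1)
      have h4 : max |β⁻¹| |β'⁻¹| ≤ r⁻¹ := by
        rw [abs_of_pos (by positivity), abs_of_pos (by positivity)]
        exact max_le (inv_anti₀ hr0 hβ) (inv_anti₀ hr0 hβ')
      have h5 : max |β⁻¹| |β'⁻¹| ^ (i + 1 - 1) ≤ r⁻¹ ^ i :=
        pow_le_pow_left₀ (le_max_of_le_left (abs_nonneg _)) h4 _
      rw [h1, norm_mul, Real.norm_of_nonneg (by positivity), Real.norm_eq_abs, mul_assoc]
      refine mul_le_mul h2 (h3.trans ?_) (abs_nonneg _) (by positivity)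
      push_cast
      calc |β⁻¹ - β'⁻¹| * ((i : ℝ) + 1) * max |β⁻¹| |β'⁻¹| ^ (i + 1 - 1)
          ≤ |β - β'| * ((i : ℝ) + 1) * r⁻¹ ^ i := by gcongr
        _ = ((i : ℝ) + 1) * r⁻¹ ^ i * |β - β'| := by ring
  rw [Real.norm_eq_abs] at hb
  refine hb.trans ?_
  gcongr
  linarith

theorem IsLexUnivoque.exists_base {r s : ℝ} (hr : 1 < r) (hrs : r < s)
    {c d x : ℕ → ℕ} (hc : IsLexUnivoque M c) (hd : IsLexUnivoque M d) (hx : IsLexUnivoque M x)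
    (hc1 : piQ r c = 1) (hd1 : piQ s d = 1) (hcx : seqLt c x) (hxd : seqLt x d) :
    ∃ β ∈ Icc r s, piQ β x = 1 := by
  obtain ⟨C, hC, hlip⟩ := exists_piQ_lipschitz M hr
  have hcont : ContinuousOn (fun β => piQ β x) (Icc r s) := by
    refine (LipschitzOnWith.of_dist_le_mul (K := ⟨C, hC.le⟩) fun β hβ β' hβ' => ?_).continuousOn
    rw [Real.dist_eq, Real.dist_eq]
    exact hlip x hx.1 β β' hβ.1 hβ'.1
  have h1 : piQ s x ≤ 1 := piQ_le_one_of_seqLe (hr.trans hrs) hx.1 hd.1 hd1 fun n => by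
    rcases Nat.eq_zero_or_pos n with rfl | hn
    · rw [shiftSeq_zero]; exact Or.inl hxd
    · exact Or.inl (seqLt_trans (hx.2 n hn).1 hxd)
  have h2 : 1 ≤ piQ r x := by
    obtain ⟨N, hN, hN'⟩ := hcx
    have h3 := piQ_sub hr hc.1 hx.1 hN
    have h4 : (c N : ℝ) + 1 ≤ x N := by exact_mod_cast hN'
    have h5 := piQ_nonneg hr (shiftSeq (N + 1) x)
    have h6 : piQ r (shiftSeq (N + 1) c) ≤ 1 :=
      piQ_le_one_of_seqLe hr (fun i => hc.1 _) hc.1 hc1 fun n => by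
        rw [shiftSeq_shiftSeq]; exact Or.inl (hc.2 _ (by omega)).1
    have h7 : 0 ≤ r ^ (N + 1) * (piQ r x - piQ r c) := by linarith
    have h8 := nonneg_of_mul_nonneg_right h7 (by positivity)
    linarith
  obtain ⟨β, hβ, hβ1⟩ := intermediate_value_Icc' hrs.le hcont ⟨h1, h2⟩
  exact ⟨β, hβ, hβ1⟩

/-- Bases of lexicographically univoque sequences that differ early are well separated. -/
theorem exists_separation {r s : ℝ} (hr : 1 < r) (hrs : r < s) (hs : s < M + 1) :
    ∃ δ : ℝ, 0 < δ ∧ ∀ x x' : ℕ → ℕ, IsLexUnivoque M x → IsLexUnivoque M x' →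
      ∀ β ∈ Icc r s, ∀ β' ∈ Icc r s, piQ β x = 1 → piQ β' x' = 1 →
      ∀ N, (∃ n ≤ N, x n ≠ x' n) → δ * ((M : ℝ) + 1)⁻¹ ^ (N + 1) ≤ |β - β'| := by
  obtain ⟨C, hC, hlip⟩ := exists_piQ_lipschitz M hr
  have hδ : 0 < M / (s - 1) - 1 := by
    have := one_lt_div_sub_one (hr.trans hrs) hs
    linarith
  have key : ∀ x x' : ℕ → ℕ, IsLexUnivoque M x → IsLexUnivoque M x' →
      ∀ β ∈ Icc r s, ∀ β' ∈ Icc r s, piQ β x = 1 → piQ β' x' = 1 →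
      ∀ n, (∀ i < n, x i = x' i) → x n < x' n →
      (M / (s - 1) - 1) / C * ((M : ℝ) + 1)⁻¹ ^ (n + 1) ≤ |β - β'| := by
    intro x x' hx hx' β hβ β' hβ' h1 h1' n hn hn'
    have hβ1' : 1 < β' := hr.trans_le hβ'.1
    have h2 := piQ_add_le_one hβ1' hx.1 hx'.1 h1' (fun k => by
      rcases Nat.eq_zero_or_pos k with rfl | hk
      · rw [shiftSeq_zero]; exact Or.inl ⟨n, hn, hn'⟩
      · exact Or.inl (seqLt_trans (hx.2 k hk).1 ⟨n, hn, hn'⟩)) hn hn'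
    have h3 := hx'.le_piQ_shift hβ1' h1' (k := n + 1) (by omega)
    have h4 := (le_abs_self _).trans (hlip x hx.1 β β' hβ.1 hβ'.1)
    have h5 : M / (s - 1) ≤ M / (β' - 1) :=
      div_le_div_of_nonneg_left (by positivity) (by linarith) (by linarith [hβ'.2])
    have h6 : (M / (s - 1) - 1) * ((M : ℝ) + 1)⁻¹ ^ (n + 1) ≤
        piQ β' (shiftSeq (n + 1) x') / β' ^ (n + 1) := by
      rw [inv_pow, ← div_eq_mul_inv]
      have h7 : β' ≤ (M : ℝ) + 1 := by linarith [hβ'.2]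
      gcongr <;> linarith
    rw [div_mul_eq_mul_div, div_le_iff₀ hC]
    linarith
  refine ⟨(M / (s - 1) - 1) / C, by positivity, fun x x' hx hx' β hβ β' hβ' h1 h1' N hN => ?_⟩
  obtain ⟨n₀, hn₀, hne⟩ := hN
  have mono : ∀ n ≤ n₀, (M / (s - 1) - 1) / C * ((M : ℝ) + 1)⁻¹ ^ (N + 1) ≤
      (M / (s - 1) - 1) / C * ((M : ℝ) + 1)⁻¹ ^ (n + 1) := fun n hn => by
    refine mul_le_mul_of_nonneg_left (pow_le_pow_of_le_one (by positivity) ?_ (by omega))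
      (by positivity)
    refine inv_le_one_of_one_le₀ ?_
    have : (0 : ℝ) ≤ M := by positivity
    linarith
  rcases seqLt_trichotomy (a := x) (b := x') fun h => hne (congrFun h _) with
    ⟨n, hn, hn'⟩ | ⟨n, hn, hn'⟩
  · have : n ≤ n₀ := by
      by_contra hlt
      exact hne (hn _ (by omega))
    exact (mono n this).trans (key x x' hx hx' β hβ β' hβ' h1 h1' n hn hn')
  · have : n ≤ n₀ := by
      by_contra hlt
      exact hne (hn _ (by omega)).symm
    rw [abs_sub_comm]
    exact (mono n this).trans (key x' x hx' hx β' hβ' β hβ h1' h1 n hn hn')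

end bases

/-- A set coded by binary sequences has positive Hausdorff dimension if points whose codes first
differ at position `e` are at distance at least `δ * ρ ^ e`. -/
theorem dimH_range_pos_of_separated {β : (ℕ → Fin 2) → ℝ} {δ ρ : ℝ} (hδ : 0 < δ) (hρ : 0 < ρ)
    (hρ1 : ρ < 1)
    (hβ : ∀ a b : ℕ → Fin 2, ∀ e, (∀ i < e, a i = b i) → a e ≠ b e → δ * ρ ^ e ≤ |β a - β b|) :
    0 < dimH (range β) := by
  classical
  have hfirst : ∀ a b : ℕ → Fin 2, a ≠ b → ∃ e, (∀ i < e, a i = b i) ∧ a e ≠ b e := fun a b h => by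
    have hex : ∃ n, a n ≠ b n := Function.ne_iff.mp h
    exact ⟨Nat.find hex, fun i hi => by simpa using Nat.find_min hex hi, Nat.find_spec hex⟩
  have hinj : Function.Injective β := fun a b hab => by
    by_contra hne
    obtain ⟨e, he, he'⟩ := hfirst a b hne
    have h1 := hβ a b e he he'
    rw [hab, sub_self, abs_zero] at h1
    have : 0 < δ * ρ ^ e := by positivity
    linarith
  set s : ℝ := Real.log 2 / -Real.log ρ with hs_def
  have hlog : Real.log ρ < 0 := Real.log_neg hρ hρ1
  have hlog2 : 0 < Real.log 2 := Real.log_pos (by norm_num)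
  have hs : 0 < s := div_pos hlog2 (by linarith)
  have hρs : ρ ^ s = 2⁻¹ := by
    have h2 : Real.log ρ * s = -Real.log 2 := by
      have := hlog.ne
      rw [hs_def]; field_simp
    rw [Real.rpow_def_of_pos hρ, h2, Real.exp_neg, Real.exp_log (by norm_num)]
  set f : ℝ → ℝ := fun y => Real.ofDigits (Function.invFun β y) with hf
  have hfβ : ∀ a, f (β a) = Real.ofDigits a := fun a => by
    simp only [hf, Function.leftInverse_invFun hinj a]
  have hbound : ∀ a b, |f (β a) - f (β b)| ≤ δ⁻¹ ^ s * |β a - β b| ^ s := fun a b => by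
    rcases eq_or_ne a b with rfl | hne
    · rw [sub_self, abs_zero]
      positivity
    obtain ⟨e, he, he'⟩ := hfirst a b hne
    rw [hfβ, hfβ]
    refine (Real.abs_ofDigits_sub_ofDigits_le he).trans ?_
    have h1 : (((2 : ℕ) : ℝ) ^ e)⁻¹ = (ρ ^ e) ^ s := by
      rw [← Real.rpow_natCast ρ e, ← Real.rpow_mul hρ.le, mul_comm, Real.rpow_mul hρ.le, hρs,
        Real.rpow_natCast, inv_pow]
      norm_num
    rw [h1, ← Real.mul_rpow (by positivity) (abs_nonneg _)]
    refine Real.rpow_le_rpow (by positivity) ?_ hs.le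
    rw [inv_mul_eq_div, le_div_iff₀ hδ, mul_comm]
    exact hβ a b e he he'
  have hHolder : HolderOnWith (δ⁻¹ ^ s).toNNReal s.toNNReal f (range β) := by
    rintro _ ⟨a, rfl⟩ _ ⟨b, rfl⟩
    rw [Real.coe_toNNReal _ hs.le, edist_dist, edist_dist, Real.dist_eq, Real.dist_eq,
      ENNReal.ofReal_rpow_of_nonneg (abs_nonneg _) hs.le]
    change _ ≤ ENNReal.ofReal _ * _
    rw [← ENNReal.ofReal_mul (by positivity)]
    exact ENNReal.ofReal_le_ofReal (hbound a b)
  have himage : Icc (0 : ℝ) 1 ⊆ f '' range β := fun y hy => by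
    obtain ⟨a, -, rfl⟩ := Real.ofDigits_SurjOn (b := 2) (by norm_num) hy
    exact ⟨β a, ⟨a, rfl⟩, hfβ a⟩
  have hdim : (1 : ENNReal) ≤ dimH (range β) / s.toNNReal := by
    refine le_trans ?_ ((dimH_mono himage).trans (hHolder.dimH_image_le (by simpa using hs)))
    rw [Real.dimH_of_nonempty_interior (by simp)]
    simp
  rw [pos_iff_ne_zero]
  intro h0
  rw [h0, ENNReal.zero_div] at hdim
  simp at hdim

/-- Flags of the sequences that code the binary sequence `a`. -/
def codeFlags (a : ℕ → Fin 2) : ℕ → Bool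
  | 0 => true
  | 1 => false
  | 2 => false
  | k + 3 => k % 2 = 0 || a (k / 2) = 1

theorem codeFlags_or (a : ℕ → Fin 2) (k : ℕ) (hk : 1 ≤ k) (h : codeFlags a k = true)
    (h' : codeFlags a (k + 1) = false) : codeFlags a (k + 2) = true := by
  match k, hk with
  | 1, _ => simp [codeFlags] at h
  | 2, _ => simp [codeFlags] at h
  | k + 3, _ =>
    rw [show k + 3 + 1 = k + 1 + 3 by omega] at h'
    rw [show k + 3 + 2 = k + 2 + 3 by omega]
    simp only [codeFlags, Bool.or_eq_false_iff, Bool.or_eq_true, decide_eq_true_eq,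
      decide_eq_false_iff_not] at h' ⊢
    omega

theorem codeFlags_apply (a : ℕ → Fin 2) (e : ℕ) : codeFlags a (4 + 2 * e) = decide (a e = 1) := by
  rw [show 4 + 2 * e = 2 * e + 1 + 3 by omega, codeFlags]
  have h : (2 * e + 1) / 2 = e := by omega
  simp [h]

theorem codeFlags_congr {a b : ℕ → Fin 2} {e : ℕ} (h : ∀ i < e, a i = b i) (k : ℕ)
    (hk : k < 4 + 2 * e) : codeFlags a k = codeFlags b k := by
  match k with
  | 0 => rfl
  | 1 => rfl
  | 2 => rfl
  | k + 3 =>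
    simp only [codeFlags]
    by_cases hk2 : k % 2 = 0
    · simp [hk2]
    · rw [h (k / 2) (by omega)]

theorem blockSeq_codeFlags_ne {M m : ℕ} {v : ℕ → ℕ} (h : IsAdmissibleWord M m v)
    {a b : ℕ → Fin 2} {e : ℕ} (he : ∀ i < e, a i = b i) (hne : a e ≠ b e) :
    blockSeq M m v false (codeFlags a) (m * (4 + 2 * e) + (m - 1)) ≠
      blockSeq M m v false (codeFlags b) (m * (4 + 2 * e) + (m - 1)) := by
  have hm := h.pos
  rw [blockSeq_apply _ _ _ (by omega), blockSeq_apply _ _ _ (by omega),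
    signSeq_congr (codeFlags_congr he), codeFlags_apply, codeFlags_apply]
  have h1 := h.last_pos (m - 1) (by omega)
  have h2 := h.le (m - 1) (by omega)
  have h3 : m - 1 + 1 = m := by omega
  have key : ∀ s, signedBlock M m v s true (m - 1) ≠ signedBlock M m v s false (m - 1) := by
    intro s
    cases s <;> simp [signedBlock, barSeq, lowerLast, h3] <;> omega
  by_cases ha : a e = 1
  · have hb : b e ≠ 1 := fun hb => hne (ha.trans hb.symm)
    simpa [ha, hb] using key _
  · have hb : b e = 1 := by omega
    simpa [ha, hb] using (key _).symm

theorem IsAdmissibleWord.isLexUnivoque_codeFlags {M m : ℕ} {v : ℕ → ℕ}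
    (h : IsAdmissibleWord M m v) (a : ℕ → Fin 2) :
    IsLexUnivoque M (blockSeq M m v false (codeFlags a)) :=
  h.isLexUnivoque_blockSeq rfl rfl rfl (codeFlags_or a)

/-- Between any three univoque bases there are enough univoque bases to fill a set of positive
Hausdorff dimension. -/
theorem dimH_univBases_inter_Icc_pos {M : ℕ} (hM : 0 < M) {r₁ r₂ r₃ : ℝ} (h₁ : r₁ ∈ UnivBases M)
    (h₂ : r₂ ∈ UnivBases M) (h₃ : r₃ ∈ UnivBases M) (h₁₂ : r₁ < r₂) (h₂₃ : r₂ < r₃)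
    (h₃M : r₃ < M + 1) : 0 < dimH (UnivBases M ∩ Icc r₁ r₃) := by
  have hr₁ : 1 < r₁ := h₁.1
  obtain ⟨c, hc, hc1⟩ := exists_isLexUnivoque h₁ (by linarith)
  obtain ⟨d, hd, hd1⟩ := exists_isLexUnivoque h₂ (by linarith)
  obtain ⟨e, he, he1⟩ := exists_isLexUnivoque h₃ h₃M
  obtain ⟨m, v, hv, hcv, hve⟩ := hc.exists_isAdmissibleWord hd
    (hc.seqLt_of_lt hr₁ h₁₂ hd hc1 hd1) (hd.seqLt_of_lt (hr₁.trans h₁₂) h₂₃ he hd1 he1)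
  have hm := hv.pos
  set x : (ℕ → Fin 2) → ℕ → ℕ := fun a => blockSeq M m v false (codeFlags a) with hx
  have hxv : ∀ a, ∀ i < m, x a i = v i := fun a i hi => by
    simp only [hx, blockSeq_apply_zero _ _ hi]
    rfl
  have hbase : ∀ a, ∃ β ∈ Icc r₁ r₃, piQ β (x a) = 1 := fun a =>
    hc.exists_base hr₁ (h₁₂.trans h₂₃) he (hv.isLexUnivoque_codeFlags a) hc1 he1
      (hcv.congr (fun _ _ => rfl) (hxv a)).seqLt (hve.congr (hxv a) fun _ _ => rfl).seqLt
  choose β hβ hβ1 using hbase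
  obtain ⟨δ, hδ, hsep⟩ := exists_separation hr₁ (h₁₂.trans h₂₃) h₃M
  have hM' : (0 : ℝ) < M := by exact_mod_cast hM
  have hpos : 0 < dimH (range β) := by
    refine dimH_range_pos_of_separated (δ := δ * ((M : ℝ) + 1)⁻¹ ^ (5 * m))
      (ρ := ((M : ℝ) + 1)⁻¹ ^ (2 * m)) (by positivity) (by positivity)
      (pow_lt_one₀ (by positivity) (inv_lt_one_of_one_lt₀ (by linarith)) (by omega))
      fun a b n hab hne => ?_
    have h1 := hsep (x a) (x b) (hv.isLexUnivoque_codeFlags a) (hv.isLexUnivoque_codeFlags b)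
      (β a) (hβ a) (β b) (hβ b) (hβ1 a) (hβ1 b) _ ⟨_, le_rfl, blockSeq_codeFlags_ne hv hab hne⟩
    have h2 : m * (4 + 2 * n) + (m - 1) + 1 = 5 * m + 2 * m * n := by
      rw [add_assoc, Nat.sub_add_cancel hm]
      ring
    rwa [h2, pow_add, pow_mul _ (2 * m), ← mul_assoc] at h1
  refine hpos.trans_le (dimH_mono ?_)
  rintro _ ⟨a, rfl⟩
  exact ⟨(hv.isLexUnivoque_codeFlags a).mem_univBases (hr₁.trans_le (hβ a).1)
    ((hβ a).2.trans_lt h₃M) (hβ1 a), hβ a⟩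

/-- A point of `closure U` other than the Komornik–Loreti constant that is not the right endpoint
of a gap is approximated by univoque bases from the left. -/
theorem exists_univBases_mem_Ioo {M : ℕ} {q : ℝ} (hqM : q ≤ M + 1)
    (hqc : q ∈ closure (UnivBases M)) (hne : q ≠ KL M) (hstar : ¬∃ a : ℝ, CC M a q) {a : ℝ}
    (ha : a < q) : ∃ r ∈ UnivBases M, r ∈ Ioo a q := by
  have hbdd : BddBelow (UnivBases M) := ⟨1, fun r hr => hr.1.le⟩
  have hnonempty : (UnivBases M).Nonempty := closure_nonempty_iff.mp ⟨q, hqc⟩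
  have hKL : KL M ∈ closure (UnivBases M) := csInf_mem_closure hnonempty hbdd
  have hKLq : KL M < q := by
    refine lt_of_le_of_ne ?_ hne.symm
    have : closure (UnivBases M) ⊆ Ici (KL M) :=
      closure_minimal (fun r hr => csInf_le hbdd hr) isClosed_Ici
    exact this hqc
  by_contra! hno
  have hgap : ∀ z ∈ closure (UnivBases M), z ∉ Ioo a q := fun z hz hz' => by
    obtain ⟨r, hr, hr'⟩ := mem_closure_iff.mp hz _ isOpen_Ioo hz'
    exact hno r hr' hr
  have hKLa : KL M ≤ a := by
    by_contra hlt
    exact hgap _ hKL ⟨not_le.mp hlt, hKLq⟩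
  set S := closure (UnivBases M) ∩ Iic a
  have hSb : BddAbove S := ⟨a, fun z hz => hz.2⟩
  have hS : sSup S ∈ S := (isClosed_closure.inter isClosed_Iic).csSup_mem ⟨_, hKL, hKLa⟩ hSb
  refine hstar ⟨sSup S, hS.2.trans_lt ha, fun z hz => ⟨⟨?_, hz.2.trans_le hqM⟩, fun hzc => ?_⟩,
    fun h => h.2 hS.1, fun h => h.2 hqc⟩
  · exact (le_csSup hSb ⟨hKL, hKLa⟩).trans_lt hz.1
  · rcases le_or_gt z a with hza | hza
    · exact (le_csSup hSb ⟨hzc, hza⟩).not_gt hz.1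
    · exact hgap z hzc ⟨hza, hz.2⟩

/-- If `q ∈ closure U`, `q ≠ q'` and `q` is not the right endpoint of any
connected component of `(q', M+1) \ closure U`, then for every `p ∈ (1, q)`
the Hausdorff dimension of `U ∩ (p, q)` is strictly positive. -/
theorem stmt6 (M : ℕ) (hM : 0 < M) (q : ℝ) (hq : q ∈ Ioc 1 ((M : ℝ) + 1))
    (hqc : q ∈ closure (UnivBases M)) (hne : q ≠ KL M)
    (hstar : ¬∃ a : ℝ, CC M a q) :
    ∀ p ∈ Ioo (1 : ℝ) q, 0 < dimH (UnivBases M ∩ Ioo p q) := by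
  rintro p ⟨-, hpq⟩
  have hleft := fun {a : ℝ} (ha : a < q) => exists_univBases_mem_Ioo hq.2 hqc hne hstar ha
  obtain ⟨r₁, h₁, hp₁, hq₁⟩ := hleft hpq
  obtain ⟨r₂, h₂, h₁₂, hq₂⟩ := hleft hq₁
  obtain ⟨r₃, h₃, h₂₃, hq₃⟩ := hleft hq₂
  refine (dimH_univBases_inter_Icc_pos hM h₁ h₂ h₃ h₁₂ h₂₃ (hq₃.trans_le hq.2)).trans_le
    (dimH_mono (inter_subset_inter_right _ (Icc_subset_Ioo hp₁ hq₃)))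

end
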